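/- arXiv:1108.2418 — 2 statements merged into one kernel-verified Lean document; each statement's English description precedes it below -/
import Mathlib

section
/- For the 2-vertex IFS on the unit interval, suppose h_v ≤ h_u and (a + g_u)(1 − a^s) ≥ b·a^s. Then H^s(F_u) = 1 and H^s(F_v) = (1 − a^s)/b^s. -/
open MeasureTheory
open scoped ENNReal NNReal

/-- `m x y` behaves like the mass given to `[x, y]` by a measure of total mass at most `p`
carried by `[0, 1]`. -/
structure IsIntervalMass (m : ℝ → ℝ → ℝ) (p : ℝ) : Prop where
  le_left : ∀ x y, m x y ≤ m 0 y
  le_right : ∀ x y, m x y ≤ m x 1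
  le_total : ∀ x y, m x y ≤ p
  of_neg : ∀ x y, y < 0 → m x y = 0
  of_one_lt : ∀ x y, 1 < x → m x y = 0

/-- The inequality between interval masses of two sets `F`, `G` inherited from
`F = a F ∪ (b G + (1 - b))`. -/
def MassRecursion (s a b : ℝ) (m n : ℝ → ℝ → ℝ) : Prop :=
  ∀ x y, m x y ≤ a ^ s * m (x / a) (y / a) + b ^ s * n ((x - (1 - b)) / b) ((y - (1 - b)) / b)

lemma one_sub_add_mul_rpow_le {s b θ t : ℝ} (hs0 : 0 < s) (hs1 : s < 1) (hb : 0 ≤ b)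
    (hbθ : b ≤ θ) (hθ : θ ≤ 1) (ht0 : 0 ≤ t) (ht1 : t ≤ 1) :
    1 - θ + θ * t ^ s ≤ (1 - b + b * t) ^ s := by
  have hc := (Real.concaveOn_rpow hs0.le hs1.le).2 (Set.mem_Ici.2 zero_le_one)
    (Set.mem_Ici.2 ht0) (by linarith : 0 ≤ 1 - b) hb (by ring)
  simp only [smul_eq_mul, Real.one_rpow, mul_one] at hc
  have h1 : t ^ s ≤ 1 := Real.rpow_le_one ht0 ht1 hs0.le
  nlinarith

lemma rpow_add_rpow_sub_le {s a w δ : ℝ} (hs0 : 0 < s) (hs1 : s < 1) (hδ : 0 ≤ δ)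
    (hδa : δ ≤ a) (haw : a < w) :
    w ^ s + (a - δ) ^ s ≤ a ^ s + (w - δ) ^ s := by
  have hpos : 0 < w - a + δ := by linarith
  set t := δ / (w - a + δ) with ht
  have ht0 : 0 ≤ t := div_nonneg hδ hpos.le
  have ht1 : t ≤ 1 := (div_le_one hpos).2 (by linarith)
  have hmul : t * (w - a + δ) = δ := div_mul_cancel₀ _ hpos.ne'
  have hconc := (Real.concaveOn_rpow hs0.le hs1.le).2
    (Set.mem_Ici.2 (by linarith : 0 ≤ a - δ)) (Set.mem_Ici.2 (by linarith : 0 ≤ w))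
  have h1 := hconc (by linarith : 0 ≤ 1 - t) ht0 (by ring)
  have h2 := hconc ht0 (by linarith : 0 ≤ 1 - t) (by ring)
  simp only [smul_eq_mul] at h1 h2
  rw [show (1 - t) * (a - δ) + t * w = a by linear_combination hmul] at h1
  rw [show t * (a - δ) + (1 - t) * w = w - δ by linear_combination -hmul] at h2
  linarith

lemma mul_rpow_div {s a x : ℝ} (ha : 0 < a) (hx : 0 ≤ x) : a ^ s * (x / a) ^ s = x ^ s := by
  rw [← Real.mul_rpow ha.le (div_nonneg hx ha.le), mul_div_cancel₀ _ ha.ne']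

section MassBounds

variable {s a b p q ρ K : ℝ} {m n : ℝ → ℝ → ℝ}

lemma initial_mass_step (hs0 : 0 < s) (hs1 : s < 1) (ha : 0 < a) (hb : 0 < b) (hab : a < 1 - b)
    (hp : 0 < p) (hm : IsIntervalMass m p) (hn : IsIntervalMass n q)
    (hrec : MassRecursion s a b m n) (hpq : p = a ^ s * p + b ^ s * q) (hcond : b ≤ 1 - a ^ s)
    (hρa : a ^ s ≤ ρ) (hρb : 1 - a ^ s ≤ ρ) (hK : 0 ≤ K)
    (hmK : ∀ y, 0 ≤ y → m 0 y ≤ p * (y ^ s + K)) (hnK : ∀ y, 0 ≤ y → n 0 y ≤ q * (y ^ s + K))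
    {y : ℝ} (hy : 0 ≤ y) : m 0 y ≤ p * (y ^ s + ρ * K) := by
  have hA : 0 < a ^ s := Real.rpow_pos_of_pos ha s
  have hB : 0 < b ^ s := Real.rpow_pos_of_pos hb s
  have hpK : 0 ≤ p * K := by positivity
  have hr := hrec 0 y
  rcases le_total 1 y with h1 | h1
  · have h2 : 1 ≤ y ^ s := Real.one_le_rpow h1 hs0.le
    have h3 : 0 ≤ ρ * K := mul_nonneg (hA.le.trans hρa) hK
    nlinarith [hm.le_total 0 y]
  rcases lt_or_ge y (1 - b) with h | h
  · rw [hn.of_neg _ _ (div_neg_of_neg_of_pos (by linarith) hb), zero_div] at hr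
    have h2 := mul_le_mul_of_nonneg_left (hmK (y / a) (by positivity)) hA.le
    have h3 := mul_rpow_div (s := s) ha hy
    nlinarith [mul_le_mul_of_nonneg_right hρa hpK]
  · set t := (y - (1 - b)) / b with ht
    have hbt : b * t = y - (1 - b) := mul_div_cancel₀ _ hb.ne'
    have ht0 : 0 ≤ t := div_nonneg (by linarith) hb.le
    have ht1 : t ≤ 1 := (div_le_one hb).2 (by linarith)
    have h1 := mul_le_mul_of_nonneg_left (hm.le_total (0 / a) (y / a)) hA.le
    have h2 := mul_le_mul_of_nonneg_left ((hn.le_left ((0 - (1 - b)) / b) t).trans (hnK t ht0)) hB.le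
    have h3 := one_sub_add_mul_rpow_le hs0 hs1 hb.le hcond (by linarith) ht0 ht1
    rw [show 1 - b + b * t = y by linarith] at h3
    have hBq : b ^ s * q = (1 - a ^ s) * p := by linarith
    have h4 : b ^ s * (q * (t ^ s + K)) = (1 - a ^ s) * p * (t ^ s + K) := by rw [← hBq]; ring
    nlinarith [mul_le_mul_of_nonneg_right hρb hpK, mul_le_mul_of_nonneg_left h3 hp.le]

lemma interval_mass_step (hs0 : 0 < s) (hs1 : s < 1) (ha : 0 < a) (hb : 0 < b) (hab : a < 1 - b)
    (hm : IsIntervalMass m p) (hn : IsIntervalMass n q) (hp : p ≤ 1)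
    (hrec : MassRecursion s a b m n) (hpq : a ^ s + b ^ s * q ≤ 1) (hcond : b ≤ 1 - a ^ s)
    (hρa : a ^ s ≤ ρ) (hρb : b ^ s ≤ ρ) (hK : 0 ≤ K)
    (hninit : ∀ y, 0 ≤ y → n 0 y ≤ q * y ^ s)
    (hmK : ∀ x y, x ≤ y → m x y ≤ (y - x) ^ s + K)
    (hnK : ∀ x y, x ≤ y → n x y ≤ (y - x) ^ s + K)
    {x y : ℝ} (hxy : x ≤ y) : m x y ≤ (y - x) ^ s + ρ * K := by
  have hA : 0 < a ^ s := Real.rpow_pos_of_pos ha s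
  have hB : 0 < b ^ s := Real.rpow_pos_of_pos hb s
  have hρaK := mul_le_mul_of_nonneg_right hρa hK
  have hρbK := mul_le_mul_of_nonneg_right hρb hK
  have hr := hrec x y
  rcases lt_or_ge y (1 - b) with h | h
  · rw [hn.of_neg _ _ (div_neg_of_neg_of_pos (by linarith) hb)] at hr
    have h2 := mul_le_mul_of_nonneg_left
      (hmK (x / a) (y / a) (div_le_div_of_nonneg_right hxy ha.le)) hA.le
    rw [← sub_div, mul_add, mul_rpow_div ha (sub_nonneg.2 hxy)] at h2
    linarith
  rcases lt_or_ge a x with h' | h'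
  · rw [hm.of_one_lt _ _ ((one_lt_div ha).2 h')] at hr
    have h2 := mul_le_mul_of_nonneg_left
      (hnK ((x - (1 - b)) / b) ((y - (1 - b)) / b)
        (div_le_div_of_nonneg_right (by linarith) hb.le)) hB.le
    rw [← sub_div, mul_add, show y - (1 - b) - (x - (1 - b)) = y - x by ring,
      mul_rpow_div hb (sub_nonneg.2 hxy)] at h2
    linarith
  have hcross : ∀ x y, 0 ≤ x → y ≤ 1 → 1 - b ≤ y → x ≤ a → m x y ≤ (y - x) ^ s + ρ * K := by
    intro x y hx hy h h'
    have hr := hrec x y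
    set t := (y - (1 - b)) / b with ht
    have hbt : b * t = y - (1 - b) := mul_div_cancel₀ _ hb.ne'
    have ht0 : 0 ≤ t := div_nonneg (by linarith) hb.le
    have ht1 : t ≤ 1 := (div_le_one hb).2 (by linarith)
    have h1 := mul_le_mul_of_nonneg_left ((hm.le_right (x / a) (y / a)).trans
      (hmK (x / a) 1 ((div_le_one ha).2 h'))) hA.le
    have h2 := mul_le_mul_of_nonneg_left
      ((hn.le_left ((x - (1 - b)) / b) t).trans (hninit t ht0)) hB.le
    rw [show 1 - x / a = (a - x) / a by field_simp, mul_add, mul_rpow_div ha (by linarith)] at h1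
    have h3 := one_sub_add_mul_rpow_le hs0 hs1 hb.le hcond (by linarith) ht0 ht1
    rw [show 1 - b + b * t = y by linarith] at h3
    have h4 := rpow_add_rpow_sub_le hs0 hs1 hx h' (by linarith : a < y)
    have h5 : b ^ s * q * t ^ s ≤ (1 - a ^ s) * t ^ s :=
      mul_le_mul_of_nonneg_right (by linarith) (Real.rpow_nonneg ht0 s)
    linarith
  have hρK : 0 ≤ ρ * K := by nlinarith
  rcases lt_or_ge x 0 with hx | hx <;> rcases le_or_gt y 1 with hy | hy
  · have := Real.rpow_le_rpow (by linarith) (by linarith : y - 0 ≤ y - x) hs0.le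
    linarith [hm.le_left x y, hcross 0 y le_rfl hy h ha.le]
  · have := Real.one_le_rpow (by linarith : 1 ≤ y - x) hs0.le
    linarith [hm.le_total x y]
  · exact hcross x y hx hy h h'
  · have := Real.rpow_le_rpow (by linarith) (by linarith : 1 - x ≤ y - x) hs0.le
    linarith [hm.le_right x y, hcross x 1 hx le_rfl (by linarith) h']

end MassBounds

lemma le_of_forall_le_add_mul_pow {u v p ρ : ℝ} (hρ0 : 0 ≤ ρ) (hρ1 : ρ < 1)
    (h : ∀ k : ℕ, u ≤ p * (v + ρ ^ k)) : u ≤ p * v := by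
  have hlim := ((tendsto_pow_atTop_nhds_zero_of_lt_one hρ0 hρ1).const_add v).const_mul p
  rw [add_zero] at hlim
  exact ge_of_tendsto' hlim h

theorem interval_mass_le {s a b c d p : ℝ} {m n : ℝ → ℝ → ℝ} (hs0 : 0 < s) (hs1 : s < 1)
    (ha : 0 < a) (hb : 0 < b) (hc : 0 < c) (hd : 0 < d) (hab : a < 1 - b) (hcd : c < 1 - d)
    (hp0 : 0 < p) (hp1 : p ≤ 1) (hm : IsIntervalMass m 1) (hn : IsIntervalMass n p)
    (hmrec : MassRecursion s a b m n) (hnrec : MassRecursion s c d n m)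
    (hmp : 1 = a ^ s + b ^ s * p) (hnp : p = c ^ s * p + d ^ s) (hcond : b ≤ 1 - a ^ s)
    {x y : ℝ} (hxy : x ≤ y) : m x y ≤ (y - x) ^ s := by
  have hA := Real.rpow_pos_of_pos ha s
  have hC := Real.rpow_pos_of_pos hc s
  have hA1 := Real.rpow_lt_one ha.le (by linarith) hs0
  have hB1 := Real.rpow_lt_one hb.le (by linarith) hs0
  have hC1 := Real.rpow_lt_one hc.le (by linarith) hs0
  have hD1 := Real.rpow_lt_one hd.le (by linarith) hs0
  have hdD : d ≤ d ^ s := Real.self_le_rpow_of_le_one hd.le (by linarith) hs1.le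
  have hcond' : d ≤ 1 - c ^ s := by nlinarith
  have hinit : ∀ y, 0 ≤ y → m 0 y ≤ 1 * y ^ s ∧ n 0 y ≤ p * y ^ s := by
    obtain ⟨ρ, hρ0, hρ1, h1, h2, h3, h4⟩ : ∃ ρ, 0 ≤ ρ ∧ ρ < 1 ∧ a ^ s ≤ ρ ∧ 1 - a ^ s ≤ ρ ∧
        c ^ s ≤ ρ ∧ 1 - c ^ s ≤ ρ :=
      ⟨max (max (a ^ s) (1 - a ^ s)) (max (c ^ s) (1 - c ^ s)), by simp [hA.le],
        by simp [hA, hC, hA1, hC1], by simp, by simp, by simp, by simp⟩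
    have key : ∀ k : ℕ, (∀ y, 0 ≤ y → m 0 y ≤ 1 * (y ^ s + ρ ^ k)) ∧
        ∀ y, 0 ≤ y → n 0 y ≤ p * (y ^ s + ρ ^ k) := by
      intro k
      induction k with
      | zero =>
        refine ⟨fun y hy => ?_, fun y hy => ?_⟩ <;> have := Real.rpow_nonneg hy s
        · linarith [hm.le_total 0 y]
        · nlinarith [hn.le_total 0 y]
      | succ k ih =>
        simp only [pow_succ']
        exact ⟨fun y hy => initial_mass_step hs0 hs1 ha hb hab one_pos hm hn hmrec
            (by linarith) hcond h1 h2 (by positivity) ih.1 ih.2 hy,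
          fun y hy => initial_mass_step hs0 hs1 hc hd hcd hp0 hn hm hnrec
            (by linarith) hcond' h3 h4 (by positivity) ih.2 ih.1 hy⟩
    exact fun y hy => ⟨le_of_forall_le_add_mul_pow hρ0 hρ1 fun k => (key k).1 y hy,
      le_of_forall_le_add_mul_pow hρ0 hρ1 fun k => (key k).2 y hy⟩
  obtain ⟨ρ, hρ0, hρ1, h1, h2, h3, h4⟩ : ∃ ρ, 0 ≤ ρ ∧ ρ < 1 ∧ a ^ s ≤ ρ ∧ b ^ s ≤ ρ ∧
      c ^ s ≤ ρ ∧ d ^ s ≤ ρ :=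
    ⟨max (max (a ^ s) (b ^ s)) (max (c ^ s) (d ^ s)), by simp [hA.le],
      by simp [hA1, hB1, hC1, hD1], by simp, by simp, by simp, by simp⟩
  have key : ∀ k : ℕ, (∀ x y, x ≤ y → m x y ≤ (y - x) ^ s + ρ ^ k) ∧
      ∀ x y, x ≤ y → n x y ≤ (y - x) ^ s + ρ ^ k := by
    intro k
    induction k with
    | zero =>
      refine ⟨fun x y h => ?_, fun x y h => ?_⟩ <;>
        have := Real.rpow_nonneg (sub_nonneg.2 h) s
      · linarith [hm.le_total x y]
      · linarith [hn.le_total x y]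
    | succ k ih =>
      simp only [pow_succ']
      exact ⟨fun x y h => interval_mass_step hs0 hs1 ha hb hab hm hn le_rfl hmrec
          hmp.ge hcond h1 h2 (by positivity) (fun y hy => (hinit y hy).2) ih.1 ih.2 h,
        fun x y h => interval_mass_step hs0 hs1 hc hd hcd hn hm hp1 hnrec
          (by nlinarith) hcond' h3 h4 (by positivity) (fun y hy => (hinit y hy).1) ih.2 ih.1 h⟩
  rw [← one_mul ((y - x) ^ s)]
  exact le_of_forall_le_add_mul_pow hρ0 hρ1 fun k => by
    rw [one_mul]; exact (key k).1 x y hxy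

lemma lipschitzWith_affine {r t : ℝ} (hr : 0 < r) :
    LipschitzWith r.toNNReal fun x : ℝ => r * x + t :=
  LipschitzWith.of_dist_le_mul fun x y => by
    simp [Real.dist_eq, ← mul_sub, abs_mul, abs_of_pos hr, hr.le]

open OuterMeasure.mkMetric' in
lemma pre_image_affine_le {s r ρ t : ℝ} (hs : 0 < s) (hr : 0 < r) (hrρ : r ≤ ρ) (δ : ℝ≥0∞)
    (E : Set ℝ) :
    pre (fun A : Set ℝ => Metric.ediam A ^ s) (ENNReal.ofReal ρ * δ) ((fun x => r * x + t) '' E) ≤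
      ENNReal.ofReal (r ^ s) * pre (fun A : Set ℝ => Metric.ediam A ^ s) δ E := by
  have hpos : ENNReal.ofReal (r ^ s) ≠ 0 := by simpa using Real.rpow_pos_of_pos hr s
  rw [← ENNReal.inv_mul_le_iff hpos ENNReal.ofReal_ne_top]
  have key : (ENNReal.ofReal (r ^ s))⁻¹ • OuterMeasure.comap (fun x => r * x + t)
      (pre (fun A : Set ℝ => Metric.ediam A ^ s) (ENNReal.ofReal ρ * δ)) ≤
      pre (fun A : Set ℝ => Metric.ediam A ^ s) δ := by
    refine le_pre.2 fun A hA => ?_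
    simp only [FunLike.coe_smul, Pi.smul_apply, OuterMeasure.comap_apply, smul_eq_mul]
    rw [ENNReal.inv_mul_le_iff hpos ENNReal.ofReal_ne_top]
    have hdiam := (lipschitzWith_affine (t := t) hr).ediam_image_le A
    refine (pre_le (hdiam.trans ?_)).trans ?_
    · gcongr
      exact ENNReal.ofReal_le_ofReal hrρ
    · rw [← ENNReal.ofReal_rpow_of_pos hr, ← ENNReal.mul_rpow_of_nonneg _ _ hs.le]
      gcongr
      exact hdiam
  exact key E

lemma hausdorffMeasure_image_affine_le {s r t : ℝ} (hs : 0 < s) (hr : 0 < r) (E : Set ℝ) :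
    μH[s] ((fun x => r * x + t) '' E) ≤ ENNReal.ofReal (r ^ s) * μH[s] E := by
  rw [← ENNReal.ofReal_rpow_of_pos hr]
  exact (lipschitzWith_affine hr).hausdorffMeasure_image_le hs.le E

/-- If the matrix of `s`-th powers of ratios of a two-vertex system of affine contractions has a
positive left eigenvector for the eigenvalue `1`, then the `s`-dimensional Hausdorff measure of an
attractor agrees with its Hausdorff content, so it is at most `1` when the diameters are. -/
theorem hausdorffMeasure_le_one_of_subset {s a b c d t₁ t₂ t₃ t₄ : ℝ} {F G : Set ℝ} (hs : 0 < s)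
    (ha : 0 < a) (hb : 0 < b) (hc : 0 < c) (hd : 0 < d)
    (ha1 : a < 1) (hb1 : b < 1) (hc1 : c < 1) (hd1 : d < 1)
    (hdim : (1 - a ^ s) * (1 - c ^ s) = b ^ s * d ^ s)
    (hF : F ⊆ (fun x => a * x + t₁) '' F ∪ (fun x => b * x + t₂) '' G)
    (hG : G ⊆ (fun x => c * x + t₃) '' G ∪ (fun x => d * x + t₄) '' F)
    (hF1 : Metric.ediam F ≤ 1) (hG1 : Metric.ediam G ≤ 1) : μH[s] F ≤ 1 := by
  have hA := Real.rpow_pos_of_pos ha s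
  have hB := Real.rpow_pos_of_pos hb s
  have hC := Real.rpow_pos_of_pos hc s
  have hD := Real.rpow_pos_of_pos hd s
  have hA1 := Real.rpow_lt_one ha.le ha1 hs
  obtain ⟨ρ, hρ0, hρ1, h1, h2, h3, h4⟩ : ∃ ρ, 0 < ρ ∧ ρ < 1 ∧ a ≤ ρ ∧ b ≤ ρ ∧ c ≤ ρ ∧ d ≤ ρ :=
    ⟨max (max a b) (max c d), by simp [ha], by simp [*], by simp, by simp, by simp, by simp⟩
  let P (k : ℕ) : OuterMeasure ℝ :=
    OuterMeasure.mkMetric'.pre (fun A : Set ℝ => Metric.ediam A ^ s) (ENNReal.ofReal ρ ^ k)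
  have hρE : ENNReal.ofReal ρ < 1 := by simpa using hρ1
  have hP (k : ℕ) : P 0 ≤ P k :=
    OuterMeasure.mkMetric'.mono_pre _ (pow_le_pow_right_of_le_one' hρE.le (Nat.zero_le k))
  have hP0 (E : Set ℝ) (hE : Metric.ediam E ≤ 1) : P 0 E ≤ 1 :=
    (OuterMeasure.mkMetric'.pre_le (by simpa using hE)).trans (ENNReal.rpow_le_one hE hs.le)
  have hstep (k : ℕ) {r r' t t' : ℝ} {E E₁ E₂ : Set ℝ} (hr : 0 < r) (hr' : 0 < r')
      (hrρ : r ≤ ρ) (hrρ' : r' ≤ ρ)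
      (hE : E ⊆ (fun x => r * x + t) '' E₁ ∪ (fun x => r' * x + t') '' E₂) :
      P (k + 1) E ≤ ENNReal.ofReal (r ^ s) * P k E₁ + ENNReal.ofReal (r' ^ s) * P k E₂ := by
    refine (measure_mono hE).trans ((measure_union_le _ _).trans ?_)
    simp only [P, pow_succ']
    exact add_le_add (pre_image_affine_le hs hr hrρ _ _) (pre_image_affine_le hs hr' hrρ' _ _)
  have hbound : ∀ k, P k F ≤ P 0 F ∧ P k G ≤ P 0 G := by
    intro k
    induction k with
    | zero => exact ⟨le_rfl, le_rfl⟩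
    | succ k ih =>
      have f0 : P 0 F ≠ ∞ := ne_top_of_le_ne_top ENNReal.one_ne_top (hP0 F hF1)
      have g0 : P 0 G ≠ ∞ := ne_top_of_le_ne_top ENNReal.one_ne_top (hP0 G hG1)
      have hf : P (k + 1) F ≤ ENNReal.ofReal (a ^ s) * P 0 F + ENNReal.ofReal (b ^ s) * P 0 G :=
        (hstep k ha hb h1 h2 hF).trans (add_le_add (mul_le_mul' le_rfl ih.1) (mul_le_mul' le_rfl ih.2))
      have hg : P (k + 1) G ≤ ENNReal.ofReal (c ^ s) * P 0 G + ENNReal.ofReal (d ^ s) * P 0 F :=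
        (hstep k hc hd h3 h4 hG).trans (add_le_add (mul_le_mul' le_rfl ih.2) (mul_le_mul' le_rfl ih.1))
      have mf := hP (k + 1) F
      have mg := hP (k + 1) G
      lift P 0 F to ℝ≥0 using f0 with x hx
      lift P 0 G to ℝ≥0 using g0 with y hy
      lift P (k + 1) F to ℝ≥0 using ne_top_of_le_ne_top (by finiteness) hf with x' hx'
      lift P (k + 1) G to ℝ≥0 using ne_top_of_le_ne_top (by finiteness) hg with y' hy'
      simp only [ENNReal.ofReal] at hf hg
      norm_cast at hf hg mf mg ⊢
      rw [← NNReal.coe_le_coe] at hf hg mf mg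
      simp only [NNReal.coe_add, NNReal.coe_mul, Real.coe_toNNReal _ hA.le,
        Real.coe_toNNReal _ hB.le, Real.coe_toNNReal _ hC.le, Real.coe_toNNReal _ hD.le] at hf hg
      rw [← NNReal.coe_le_coe, ← NNReal.coe_le_coe]
      have hf' := mul_le_mul_of_nonneg_left hf hD.le
      have hg' := mul_le_mul_of_nonneg_left hg (by linarith : 0 ≤ 1 - a ^ s)
      have hsum : d ^ s * ((x' : ℝ) - x) + (1 - a ^ s) * ((y' : ℝ) - y) ≤ 0 := by
        linear_combination hf' + hg' - (y : ℝ) * hdim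
      constructor <;> nlinarith
  rw [Measure.hausdorffMeasure, ← OuterMeasure.coe_mkMetric, OuterMeasure.mkMetric,
    OuterMeasure.mkMetric']
  simp only [OuterMeasure.iSup_apply]
  refine iSup₂_le fun δ hδ => ?_
  obtain ⟨k, hk⟩ := ((ENNReal.tendsto_pow_atTop_nhds_zero_of_lt_one hρE).eventually_le_const
    hδ).exists
  exact (OuterMeasure.mkMetric'.mono_pre _ hk F).trans ((hbound k).1.trans (hP0 F hF1))

lemma isIntervalMass_hausdorffMeasure {s h M : ℝ} {F : Set ℝ} (hF : F ⊆ Set.Icc 0 1)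
    (hh : 0 < h) (hM : 0 ≤ M) (hFM : μH[s] F = ENNReal.ofReal M) :
    IsIntervalMass (fun x y => (μH[s] (F ∩ Set.Icc x y)).toReal / h) (M / h) := by
  have hmono {A B : Set ℝ} (hAB : F ∩ A ⊆ F ∩ B) :
      (μH[s] (F ∩ A)).toReal / h ≤ (μH[s] (F ∩ B)).toReal / h := by
    refine div_le_div_of_nonneg_right (ENNReal.toReal_mono ?_ (measure_mono hAB)) hh.le
    exact measure_ne_top_of_subset Set.inter_subset_left (by simp [hFM])
  refine ⟨fun x y => hmono fun z hz => ⟨hz.1, (hF hz.1).1, hz.2.2⟩,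
    fun x y => hmono fun z hz => ⟨hz.1, hz.2.1, (hF hz.1).2⟩, fun x y => ?_, fun x y hy => ?_,
    fun x y hx => ?_⟩
  · refine (hmono (B := Set.univ) (by simp)).trans ?_
    simp [hFM, hM]
  · have : F ∩ Set.Icc x y = ∅ :=
      Set.eq_empty_of_forall_notMem fun z hz => by linarith [(hF hz.1).1, hz.2.2]
    simp [this]
  · have : F ∩ Set.Icc x y = ∅ :=
      Set.eq_empty_of_forall_notMem fun z hz => by linarith [(hF hz.1).2, hz.2.1]
    simp [this]

lemma massRecursion_hausdorffMeasure {s a b h : ℝ} {F G : Set ℝ} (hs : 0 < s) (ha : 0 < a)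
    (hb : 0 < b) (hh : 0 < h) (hF : μH[s] F ≠ ∞) (hG : μH[s] G ≠ ∞)
    (hFG : F ⊆ (fun x => a * x + 0) '' F ∪ (fun x => b * x + (1 - b)) '' G) :
    MassRecursion s a b (fun x y => (μH[s] (F ∩ Set.Icc x y)).toReal / h)
      (fun x y => (μH[s] (G ∩ Set.Icc x y)).toReal / h) := by
  intro x y
  have hF' (u v : ℝ) : μH[s] (F ∩ Set.Icc u v) ≠ ∞ :=
    measure_ne_top_of_subset Set.inter_subset_left hF
  have hG' (u v : ℝ) : μH[s] (G ∩ Set.Icc u v) ≠ ∞ :=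
    measure_ne_top_of_subset Set.inter_subset_left hG
  have hsub : F ∩ Set.Icc x y ⊆ (fun x => a * x + 0) '' (F ∩ Set.Icc (x / a) (y / a)) ∪
      (fun x => b * x + (1 - b)) '' (G ∩ Set.Icc ((x - (1 - b)) / b) ((y - (1 - b)) / b)) := by
    rintro z ⟨hz, hxz, hzy⟩
    rcases hFG hz with ⟨w, hw, rfl⟩ | ⟨w, hw, rfl⟩
    · refine Or.inl ⟨w, ⟨hw, ?_, ?_⟩, rfl⟩
      · rw [div_le_iff₀ ha]; linarith
      · rw [le_div_iff₀ ha]; linarith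
    · refine Or.inr ⟨w, ⟨hw, ?_, ?_⟩, rfl⟩
      · rw [div_le_iff₀ hb]; linarith
      · rw [le_div_iff₀ hb]; linarith
  have hle := (measure_mono hsub).trans ((measure_union_le _ _).trans (add_le_add
    (hausdorffMeasure_image_affine_le hs ha _) (hausdorffMeasure_image_affine_le hs hb _)))
  have hF'' := ENNReal.mul_ne_top (ENNReal.ofReal_ne_top (r := a ^ s)) (hF' (x / a) (y / a))
  have hG'' := ENNReal.mul_ne_top (ENNReal.ofReal_ne_top (r := b ^ s))
    (hG' ((x - (1 - b)) / b) ((y - (1 - b)) / b))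
  have hreal := ENNReal.toReal_mono (ENNReal.add_ne_top.2 ⟨hF'', hG''⟩) hle
  rw [ENNReal.toReal_add hF'' hG'', ENNReal.toReal_mul,
    ENNReal.toReal_mul, ENNReal.toReal_ofReal (Real.rpow_nonneg ha.le s),
    ENNReal.toReal_ofReal (Real.rpow_nonneg hb.le s)] at hreal
  refine (div_le_div_of_nonneg_right hreal hh.le).trans_eq ?_
  ring

/-- The mass distribution principle on the line, tested on intervals. -/
theorem one_le_of_hausdorffMeasure_inter_Icc_le {s h : ℝ} {F : Set ℝ} (hs : 0 < s) (hh : 0 < h)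
    (hFm : MeasurableSet F) (hF : μH[s] F = ENNReal.ofReal h)
    (hle : ∀ x y, x ≤ y → (μH[s] (F ∩ Set.Icc x y)).toReal / h ≤ (y - x) ^ s) : 1 ≤ h := by
  have hpos : ENNReal.ofReal h ≠ 0 := by simpa using hh
  have key : (ENNReal.ofReal h)⁻¹ • (μH[s] : Measure ℝ).restrict F ≤ μH[s] := by
    refine Measure.le_hausdorffMeasure s _ 1 one_pos fun E hE => ?_
    rcases E.eq_empty_or_nonempty with rfl | hne
    · simp
    have hbdd : Bornology.IsBounded E :=
      Metric.isBounded_iff_ediam_ne_top.2 (ne_top_of_le_ne_top ENNReal.one_ne_top hE)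
    have hsub := hbdd.subset_Icc_sInf_sSup
    have hxy : sInf E ≤ sSup E := Real.sInf_le_sSup E hbdd.bddBelow hbdd.bddAbove
    rw [Real.ediam_eq hbdd, Measure.smul_apply, smul_eq_mul,
      ENNReal.inv_mul_le_iff hpos ENNReal.ofReal_ne_top]
    refine (measure_mono hsub).trans ?_
    rw [Measure.restrict_apply' hFm, Set.inter_comm,
      ENNReal.ofReal_rpow_of_nonneg (sub_nonneg.2 hxy) hs.le, ← ENNReal.ofReal_mul hh.le]
    have hfin : μH[s] (F ∩ Set.Icc (sInf E) (sSup E)) ≠ ∞ :=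
      measure_ne_top_of_subset Set.inter_subset_left (by simp [hF])
    rw [← ENNReal.ofReal_toReal hfin]
    refine ENNReal.ofReal_le_ofReal ?_
    have := hle _ _ hxy
    rwa [div_le_iff₀ hh, mul_comm] at this
  have h1 := key F
  rw [Measure.smul_apply, Measure.restrict_apply_self, hF, smul_eq_mul,
    ENNReal.inv_mul_cancel hpos ENNReal.ofReal_ne_top] at h1
  exact ENNReal.one_le_ofReal.1 h1



theorem stmt10
    (a gu b c gv d : ℝ)
    (ha : 0 < a) (hgu : 0 < gu) (hb : 0 < b) (hc : 0 < c) (hgv : 0 < gv) (hd : 0 < d)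
    (hsum1 : a + gu + b = 1) (hsum2 : c + gv + d = 1)
    (Fu Fv : Set ℝ)
    (hFuc : IsCompact Fu) (hFvc : IsCompact Fv)
    (hFu0 : (0 : ℝ) ∈ Fu) (hFu1 : (1 : ℝ) ∈ Fu) (hFusub : Fu ⊆ Set.Icc 0 1)
    (hFv0 : (0 : ℝ) ∈ Fv) (hFv1 : (1 : ℝ) ∈ Fv) (hFvsub : Fv ⊆ Set.Icc 0 1)
    (hFu : Fu = (fun x => a * x) '' Fu ∪ (fun x => b * x + (a + gu)) '' Fv)
    (hFv : Fv = (fun x => c * x) '' Fv ∪ (fun x => d * x + (c + gv)) '' Fu)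
    (s : ℝ) (hs0 : 0 < s) (hs1 : s < 1)
    (hdim : (1 - a ^ s) * (1 - c ^ s) = b ^ s * d ^ s)
    (hu hv : ℝ) (hhu0 : 0 < hu) (hhv0 : 0 < hv)
    (hhuH : μH[s] Fu = ENNReal.ofReal hu) (hhvH : μH[s] Fv = ENNReal.ofReal hv)
    (heigu : hu = a ^ s * hu + b ^ s * hv)
    (heigv : hv = d ^ s * hu + c ^ s * hv)
    (hcond2 : hv ≤ hu)
    (hcond3 : b * a ^ s ≤ (a + gu) * (1 - a ^ s))
    :
    μH[s] Fu = 1 ∧ μH[s] Fv = ENNReal.ofReal ((1 - a ^ s) / b ^ s) := by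
  have hA := Real.rpow_pos_of_pos ha s
  have hB := Real.rpow_pos_of_pos hb s
  have hFu' : Fu ⊆ (fun x => a * x + 0) '' Fu ∪ (fun x => b * x + (1 - b)) '' Fv := by
    rw [show 1 - b = a + gu by linarith]
    simpa only [add_zero] using hFu.subset
  have hFv' : Fv ⊆ (fun x => c * x + 0) '' Fv ∪ (fun x => d * x + (1 - d)) '' Fu := by
    rw [show 1 - d = c + gv by linarith]
    simpa only [add_zero] using hFv.subset
  have hdiam {E : Set ℝ} (hE : E ⊆ Set.Icc 0 1) : Metric.ediam E ≤ 1 :=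
    (Metric.ediam_mono hE).trans (by simp [Real.ediam_Icc])
  have hu_le : hu ≤ 1 := by
    rw [← ENNReal.ofReal_le_one, ← hhuH]
    exact hausdorffMeasure_le_one_of_subset hs0 ha hb hc hd (by linarith) (by linarith)
      (by linarith) (by linarith) hdim hFu' hFv' (hdiam hFusub) (hdiam hFvsub)
  have hu_fin : μH[s] Fu ≠ ∞ := by simp [hhuH]
  have hv_fin : μH[s] Fv ≠ ∞ := by simp [hhvH]
  have hmass := isIntervalMass_hausdorffMeasure hFusub hhu0 hhu0.le hhuH
  rw [div_self hhu0.ne'] at hmass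
  have hu_ge : 1 ≤ hu := by
    refine one_le_of_hausdorffMeasure_inter_Icc_le hs0 hhu0 hFuc.measurableSet hhuH fun x y hxy =>
      interval_mass_le hs0 hs1 ha hb hc hd (by linarith) (by linarith) (div_pos hhv0 hhu0)
      ((div_le_one hhu0).2 hcond2) hmass
      (isIntervalMass_hausdorffMeasure hFvsub hhu0 hhv0.le hhvH)
      (massRecursion_hausdorffMeasure hs0 ha hb hhu0 hu_fin hv_fin hFu')
      (massRecursion_hausdorffMeasure hs0 hc hd hhu0 hv_fin hu_fin hFv') ?_ ?_ ?_ hxy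
    · field_simp
      linarith
    · field_simp
      linarith
    · have : a + gu = 1 - b := by linarith
      rw [this] at hcond3
      linarith
  have hu_eq : hu = 1 := le_antisymm hu_le hu_ge
  refine ⟨by rw [hhuH, hu_eq, ENNReal.ofReal_one], ?_⟩
  rw [hhvH]
  congr 1
  rw [eq_div_iff hB.ne']
  rw [hu_eq] at heigu
  linarith
end

section
/- For the 2-vertex IFS on the unit interval, if g_u, g_v, a, b, c, d are multiplicatively rationally independent, then the attractor F_u is not the attractor of any standard (1-vertex) IFS on ℝ satisfying the convex strong separation condition: there do not exist n ≥ 2 and contracting similarities T₁, …, T_n : ℝ → ℝ such that F_u = ⋃_{i=1}^{n} T_i(F_u) and the intervals T_i([0,1]), 1 ≤ i ≤ n, are pairwise disjoint (note [0,1] is the convex hull of F_u). -/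
open MeasureTheory
open scoped ENNReal NNReal

/-- `ℓ` is the length of a bounded gap `(x, y)` of `F`, with both endpoints in `F`. -/
def IsGapLength (F : Set ℝ) (ℓ : ℝ) : Prop :=
  ∃ x ∈ F, ∃ y ∈ F, x < y ∧ ℓ = y - x ∧ ∀ z ∈ F, x < z → y ≤ z

section TwoPieces

variable {F G H : Set ℝ} {p g q ℓ : ℝ}

lemma IsGapLength.cases_of_eq_union
    (hp : 0 < p) (hg : 0 < g) (hq : 0 < q)
    (hG1 : (1 : ℝ) ∈ G) (hG : G ⊆ Set.Icc 0 1) (hH0 : (0 : ℝ) ∈ H) (hH : H ⊆ Set.Icc 0 1)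
    (hF : F = (fun x => p * x) '' G ∪ (fun x => q * x + (p + g)) '' H)
    (h : IsGapLength F ℓ) :
    ℓ = g ∨ (∃ k, IsGapLength G k ∧ ℓ = p * k) ∨ ∃ k, IsGapLength H k ∧ ℓ = q * k := by
  obtain ⟨x, hx, y, hy, hxy, rfl, hgap⟩ := h
  have hFG : ∀ z ∈ G, p * z ∈ F := fun z hz => hF ▸ Or.inl ⟨z, hz, rfl⟩
  have hFH : ∀ z ∈ H, q * z + (p + g) ∈ F := fun z hz => hF ▸ Or.inr ⟨z, hz, rfl⟩
  rw [hF] at hx hy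
  rcases hx with ⟨x, hx, rfl⟩ | ⟨x, hx, rfl⟩ <;> rcases hy with ⟨y, hy, rfl⟩ | ⟨y, hy, rfl⟩ <;>
    dsimp only at hxy hgap ⊢
  · refine Or.inr (Or.inl ⟨y - x, ⟨x, hx, y, hy, by nlinarith, rfl, fun z hz hxz => ?_⟩, by ring⟩)
    have := hgap _ (hFG z hz) (by nlinarith)
    nlinarith
  · left
    have hx1 := (hG hx).2
    have hy0 := (hH hy).1
    have h1 : p * 1 ≤ p * x := by
      by_contra! hlt
      have := hgap _ (hFG 1 hG1) hlt
      nlinarith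
    have h2 := hgap _ (hFH 0 hH0) (by nlinarith)
    nlinarith
  · have hx0 := (hH hx).1
    have hy1 := (hG hy).2
    nlinarith
  · refine Or.inr (Or.inr ⟨y - x, ⟨x, hx, y, hy, by nlinarith, rfl, fun z hz hxz => ?_⟩, by ring⟩)
    have := hgap _ (hFH z hz) (by nlinarith)
    nlinarith

lemma isGapLength_middle
    (hp : 0 < p) (hg : 0 < g) (hq : 0 < q)
    (hG1 : (1 : ℝ) ∈ G) (hG : G ⊆ Set.Icc 0 1) (hH0 : (0 : ℝ) ∈ H) (hH : H ⊆ Set.Icc 0 1)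
    (hF : F = (fun x => p * x) '' G ∪ (fun x => q * x + (p + g)) '' H) :
    IsGapLength F g := by
  refine ⟨p, hF ▸ Or.inl ⟨1, hG1, mul_one p⟩, p + g, hF ▸ Or.inr ⟨0, hH0, by simp⟩, by linarith,
    by ring, fun z hz hxz => ?_⟩
  rw [hF] at hz
  rcases hz with ⟨z, hz, rfl⟩ | ⟨z, hz, rfl⟩ <;> dsimp only at hxz ⊢
  · have := (hG hz).2
    nlinarith
  · have := (hH hz).1
    nlinarith

lemma IsGapLength.left_piece
    (hp : 0 < p) (hg : 0 < g) (hq : 0 < q)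
    (hG : G ⊆ Set.Icc 0 1) (hH : H ⊆ Set.Icc 0 1)
    (hF : F = (fun x => p * x) '' G ∪ (fun x => q * x + (p + g)) '' H)
    (h : IsGapLength G ℓ) : IsGapLength F (p * ℓ) := by
  obtain ⟨x, hx, y, hy, hxy, rfl, hgap⟩ := h
  refine ⟨p * x, hF ▸ Or.inl ⟨x, hx, rfl⟩, p * y, hF ▸ Or.inl ⟨y, hy, rfl⟩, by nlinarith,
    by ring, fun z hz hxz => ?_⟩
  rw [hF] at hz
  rcases hz with ⟨z, hz, rfl⟩ | ⟨z, hz, rfl⟩ <;> dsimp only at hxz ⊢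
  · have := hgap z hz (by nlinarith)
    nlinarith
  · have := (hH hz).1
    have := (hG hy).2
    nlinarith

lemma IsGapLength.right_piece
    (hp : 0 < p) (hg : 0 < g) (hq : 0 < q)
    (hG : G ⊆ Set.Icc 0 1) (hH : H ⊆ Set.Icc 0 1)
    (hF : F = (fun x => p * x) '' G ∪ (fun x => q * x + (p + g)) '' H)
    (h : IsGapLength H ℓ) : IsGapLength F (q * ℓ) := by
  obtain ⟨x, hx, y, hy, hxy, rfl, hgap⟩ := h
  refine ⟨q * x + (p + g), hF ▸ Or.inr ⟨x, hx, rfl⟩, q * y + (p + g), hF ▸ Or.inr ⟨y, hy, rfl⟩,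
    by nlinarith, by ring, fun z hz hxz => ?_⟩
  rw [hF] at hz
  rcases hz with ⟨z, hz, rfl⟩ | ⟨z, hz, rfl⟩ <;> dsimp only at hxz ⊢
  · have := (hG hz).2
    have := (hH hx).1
    nlinarith
  · have := hgap z hz (by nlinarith)
    nlinarith

end TwoPieces

lemma IsGapLength.le_one {F : Set ℝ} {ℓ : ℝ} (hF : F ⊆ Set.Icc 0 1) (h : IsGapLength F ℓ) :
    ℓ ≤ 1 := by
  obtain ⟨x, hx, y, hy, -, rfl, -⟩ := h
  linarith [(hF hx).1, (hF hy).2]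

lemma IsGapLength.pos {F : Set ℝ} {ℓ : ℝ} (h : IsGapLength F ℓ) : 0 < ℓ := by
  obtain ⟨x, -, y, -, hxy, rfl, -⟩ := h
  linarith

/-- The products of one gap `g` or `g'` with the edge ratios along a directed path which starts at
a vertex with gap `g` and loop ratio `a`, the other vertex having gap `g'` and loop ratio `c`. -/
def IsPathGap (g a b g' c d ℓ : ℝ) : Prop :=
  (∃ i k j : ℕ, (k = 0 → j = 0) ∧ ℓ = g * a ^ i * (b * d) ^ k * c ^ j) ∨
    ∃ i k j : ℕ, ℓ = g' * a ^ i * b ^ (k + 1) * d ^ k * c ^ j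

lemma isPathGap_self (g a b g' c d : ℝ) : IsPathGap g a b g' c d g :=
  Or.inl ⟨0, 0, 0, fun _ => rfl, by simp⟩

lemma IsPathGap.loop {g a b g' c d ℓ : ℝ} (h : IsPathGap g a b g' c d ℓ) :
    IsPathGap g a b g' c d (a * ℓ) := by
  rcases h with ⟨i, k, j, hkj, rfl⟩ | ⟨i, k, j, rfl⟩
  · exact Or.inl ⟨i + 1, k, j, hkj, by ring⟩
  · exact Or.inr ⟨i + 1, k, j, by ring⟩

lemma IsPathGap.cross {g a b g' c d ℓ : ℝ} (h : IsPathGap g' c d g a b ℓ) :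
    IsPathGap g a b g' c d (b * ℓ) := by
  rcases h with ⟨i, k, j, -, rfl⟩ | ⟨i, k, j, rfl⟩
  · exact Or.inr ⟨j, k, i, by ring⟩
  · exact Or.inl ⟨j, k + 1, i, by simp, by ring⟩

lemma IsGapLength.isPathGap {a gu b c gv d : ℝ}
    (ha : 0 < a) (hgu : 0 < gu) (hb : 0 < b) (hc : 0 < c) (hgv : 0 < gv) (hd : 0 < d)
    (hsum1 : a + gu + b = 1) (hsum2 : c + gv + d = 1)
    {Fu Fv : Set ℝ}
    (hFu0 : (0 : ℝ) ∈ Fu) (hFu1 : (1 : ℝ) ∈ Fu) (hFusub : Fu ⊆ Set.Icc 0 1)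
    (hFv0 : (0 : ℝ) ∈ Fv) (hFv1 : (1 : ℝ) ∈ Fv) (hFvsub : Fv ⊆ Set.Icc 0 1)
    (hFu : Fu = (fun x => a * x) '' Fu ∪ (fun x => b * x + (a + gu)) '' Fv)
    (hFv : Fv = (fun x => c * x) '' Fv ∪ (fun x => d * x + (c + gv)) '' Fu)
    {ℓ : ℝ} (h : IsGapLength Fu ℓ) : IsPathGap gu a b gv c d ℓ := by
  obtain ⟨ρ, hρ1, hρa, hρb, hρc, hρd⟩ :
      ∃ ρ : ℝ, ρ < 1 ∧ a ≤ ρ ∧ b ≤ ρ ∧ c ≤ ρ ∧ d ≤ ρ :=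
    ⟨max (max a b) (max c d),
      max_lt (max_lt (by linarith) (by linarith)) (max_lt (by linarith) (by linarith)),
      by simp, by simp, by simp, by simp⟩
  have hρ0 : 0 < ρ := ha.trans_le hρa
  have step : ∀ {N : ℕ} {t k : ℝ}, 0 < k → t ≤ ρ → ρ ^ (N + 1) < t * k → ρ ^ N < k := by
    intro N t k hk ht hlt
    rw [pow_succ] at hlt
    nlinarith
  have key : ∀ N : ℕ,
      (∀ ℓ, IsGapLength Fu ℓ → ρ ^ N < ℓ → IsPathGap gu a b gv c d ℓ) ∧
        ∀ ℓ, IsGapLength Fv ℓ → ρ ^ N < ℓ → IsPathGap gv c d gu a b ℓ := by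
    intro N
    induction N with
    | zero =>
      exact ⟨fun ℓ hℓ hlt => absurd (hℓ.le_one hFusub) (by simpa using hlt),
        fun ℓ hℓ hlt => absurd (hℓ.le_one hFvsub) (by simpa using hlt)⟩
    | succ N ih =>
      refine ⟨fun ℓ hℓ hlt => ?_, fun ℓ hℓ hlt => ?_⟩
      · rcases hℓ.cases_of_eq_union ha hgu hb hFu1 hFusub hFv0 hFvsub hFu with
          rfl | ⟨k, hk, rfl⟩ | ⟨k, hk, rfl⟩
        · exact isPathGap_self _ _ _ _ _ _
        · exact (ih.1 k hk (step hk.pos hρa hlt)).loop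
        · exact (ih.2 k hk (step hk.pos hρb hlt)).cross
      · rcases hℓ.cases_of_eq_union hc hgv hd hFv1 hFvsub hFu0 hFusub hFv with
          rfl | ⟨k, hk, rfl⟩ | ⟨k, hk, rfl⟩
        · exact isPathGap_self _ _ _ _ _ _
        · exact (ih.2 k hk (step hk.pos hρc hlt)).loop
        · exact (ih.1 k hk (step hk.pos hρd hlt)).cross
  obtain ⟨N, hN⟩ := exists_pow_lt_of_lt_one h.pos hρ1
  exact (key N).1 ℓ h hN

lemma exists_affine_of_abs_sub_eq {T : ℝ → ℝ} {r : ℝ} (hr : 0 < r)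
    (hT : ∀ x y, |T x - T y| = r * |x - y|) :
    ∃ s t : ℝ, |s| = r ∧ ∀ x, T x = s * x + t := by
  have hsq : ∀ x y, (T x - T y) ^ 2 = r ^ 2 * (x - y) ^ 2 := fun x y => by
    rw [← sq_abs, hT, mul_pow, sq_abs]
  refine ⟨T 1 - T 0, T 0, by simpa using hT 1 0, fun x => ?_⟩
  have h1 := hsq x 0
  have h2 := hsq x 1
  have h3 := hsq 1 0
  have hne : T 1 - T 0 ≠ 0 := fun h0 => by
    rw [h0] at h3
    nlinarith
  apply mul_left_cancel₀ hne
  linear_combination (h1 - h2 + (1 - 2 * x) * h3) / 2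

lemma mem_image_Icc_of_between {T : ℝ → ℝ} {s t x y z : ℝ}
    (hT : ∀ x, T x = s * x + t) {u v : ℝ}
    (hx : x ∈ T '' Set.Icc u v) (hy : y ∈ T '' Set.Icc u v) (hxz : x ≤ z) (hzy : z ≤ y) :
    z ∈ T '' Set.Icc u v := by
  have hcont : Continuous T := by
    rw [funext hT]
    fun_prop
  exact ((isPreconnected_Icc.image T hcont.continuousOn).ordConnected).out hx hy ⟨hxz, hzy⟩

lemma IsGapLength.of_image {F : Set ℝ} {T : ℝ → ℝ} {s t x y : ℝ}
    (hT : ∀ x, T x = s * x + t) (hTF : ∀ z ∈ F, T z ∈ F)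
    (hx : x ∈ T '' F) (hy : y ∈ T '' F) (hxy : x < y) (hgap : ∀ z ∈ F, x < z → y ≤ z) :
    ∃ k, IsGapLength F k ∧ y - x = |s| * k := by
  obtain ⟨x, hx, rfl⟩ := hx
  obtain ⟨y, hy, rfl⟩ := hy
  rw [hT, hT] at hxy
  simp only [hT] at hgap hTF ⊢
  rcases lt_trichotomy s 0 with hs | rfl | hs
  · rw [abs_of_neg hs]
    refine ⟨x - y, ⟨y, hy, x, hx, by nlinarith, rfl, fun z hz hyz => ?_⟩, by ring⟩
    by_contra! hzx
    have := hgap _ (hTF z hz) (by nlinarith)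
    nlinarith
  · linarith
  · rw [abs_of_pos hs]
    refine ⟨y - x, ⟨x, hx, y, hy, by nlinarith, rfl, fun z hz hxz => ?_⟩, by ring⟩
    have := hgap _ (hTF z hz) (by nlinarith)
    nlinarith

lemma IsGapLength.image {F : Set ℝ} {T : ℝ → ℝ} {s t ℓ : ℝ} (hs : s ≠ 0)
    (hT : ∀ x, T x = s * x + t) (hTF : ∀ z ∈ F, T z ∈ F)
    (hF : F ⊆ Set.Icc 0 1) (hsep : ∀ z ∈ F, z ∈ T '' Set.Icc 0 1 → z ∈ T '' F)
    (h : IsGapLength F ℓ) : IsGapLength F (|s| * ℓ) := by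
  obtain ⟨x, hx, y, hy, hxy, rfl, hgap⟩ := h
  have hx' := Set.mem_image_of_mem T (hF hx)
  have hy' := Set.mem_image_of_mem T (hF hy)
  rcases hs.lt_or_gt with hs | hs
  · rw [abs_of_neg hs]
    refine ⟨T y, hTF y hy, T x, hTF x hx, ?_, ?_, fun z hz hxz => ?_⟩
    · rw [hT, hT]
      nlinarith
    · rw [hT, hT]
      ring
    · by_contra! hzy
      obtain ⟨w, hw, rfl⟩ := hsep z hz (mem_image_Icc_of_between hT hy' hx' hxz.le hzy.le)
      rw [hT, hT] at hxz hzy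
      have := hgap w hw (by nlinarith)
      nlinarith
  · rw [abs_of_pos hs]
    refine ⟨T x, hTF x hx, T y, hTF y hy, ?_, ?_, fun z hz hxz => ?_⟩
    · rw [hT, hT]
      nlinarith
    · rw [hT, hT]
      ring
    · by_contra! hzy
      obtain ⟨w, hw, rfl⟩ := hsep z hz (mem_image_Icc_of_between hT hx' hy' hxz.le hzy.le)
      rw [hT, hT] at hxz hzy
      have := hgap w hw (by nlinarith)
      nlinarith

lemma natExponents_eq_of_independent {gu gv a b c d : ℝ}
    (hgu : 0 < gu) (hgv : 0 < gv) (ha : 0 < a) (hb : 0 < b) (hc : 0 < c) (hd : 0 < d)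
    (hind : ∀ m1 m2 m3 m4 m5 m6 : ℤ,
      gu ^ m1 * gv ^ m2 * a ^ m3 * b ^ m4 * c ^ m5 * d ^ m6 = 1 →
      m1 = 0 ∧ m2 = 0 ∧ m3 = 0 ∧ m4 = 0 ∧ m5 = 0 ∧ m6 = 0)
    {m1 m2 m3 m4 m5 m6 n1 n2 n3 n4 n5 n6 : ℕ}
    (h : gu ^ m1 * gv ^ m2 * a ^ m3 * b ^ m4 * c ^ m5 * d ^ m6 =
      gu ^ n1 * gv ^ n2 * a ^ n3 * b ^ n4 * c ^ n5 * d ^ n6) :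
    m1 = n1 ∧ m2 = n2 ∧ m3 = n3 ∧ m4 = n4 ∧ m5 = n5 ∧ m6 = n6 := by
  have := hind (m1 - n1) (m2 - n2) (m3 - n3) (m4 - n4) (m5 - n5) (m6 - n6) (by
    rw [zpow_sub₀ hgu.ne', zpow_sub₀ hgv.ne', zpow_sub₀ ha.ne', zpow_sub₀ hb.ne',
      zpow_sub₀ hc.ne', zpow_sub₀ hd.ne']
    simp only [zpow_natCast, div_mul_div_comm]
    rw [h, div_self (by positivity)])
  omega

theorem stmt14
    (a gu b c gv d : ℝ)
    (ha : 0 < a) (hgu : 0 < gu) (hb : 0 < b) (hc : 0 < c) (hgv : 0 < gv) (hd : 0 < d)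
    (hsum1 : a + gu + b = 1) (hsum2 : c + gv + d = 1)
    (Fu Fv : Set ℝ)
    (hFuc : IsCompact Fu) (hFvc : IsCompact Fv)
    (hFu0 : (0 : ℝ) ∈ Fu) (hFu1 : (1 : ℝ) ∈ Fu) (hFusub : Fu ⊆ Set.Icc 0 1)
    (hFv0 : (0 : ℝ) ∈ Fv) (hFv1 : (1 : ℝ) ∈ Fv) (hFvsub : Fv ⊆ Set.Icc 0 1)
    (hFu : Fu = (fun x => a * x) '' Fu ∪ (fun x => b * x + (a + gu)) '' Fv)
    (hFv : Fv = (fun x => c * x) '' Fv ∪ (fun x => d * x + (c + gv)) '' Fu)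
    (hind : ∀ m1 m2 m3 m4 m5 m6 : ℤ,
      gu ^ m1 * gv ^ m2 * a ^ m3 * b ^ m4 * c ^ m5 * d ^ m6 = 1 →
      m1 = 0 ∧ m2 = 0 ∧ m3 = 0 ∧ m4 = 0 ∧ m5 = 0 ∧ m6 = 0)
    :
    ¬ ∃ (n : ℕ) (T : Fin n → ℝ → ℝ) (rT : Fin n → ℝ),
      2 ≤ n ∧ (∀ i, 0 < rT i ∧ rT i < 1) ∧
      (∀ i x y, |T i x - T i y| = rT i * |x - y|) ∧
      Fu = ⋃ i, T i '' Fu ∧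
      (∀ i j, i ≠ j → Disjoint (T i '' Set.Icc (0 : ℝ) 1) (T j '' Set.Icc (0 : ℝ) 1)) := by
  rintro ⟨n, T, rT, -, hr, hT, hcover, hdisj⟩
  have hexp := @natExponents_eq_of_independent gu gv a b c d hgu hgv ha hb hc hd hind
  have hpath : ∀ {ℓ : ℝ}, IsGapLength Fu ℓ → IsPathGap gu a b gv c d ℓ := fun h =>
    h.isPathGap ha hgu hb hc hgv hd hsum1 hsum2 hFu0 hFu1 hFusub hFv0 hFv1 hFvsub hFu hFv
  have hgapu : IsGapLength Fu gu := isGapLength_middle ha hgu hb hFu1 hFusub hFv0 hFvsub hFu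
  have hgapv : IsGapLength Fv gv := isGapLength_middle hc hgv hd hFv1 hFvsub hFu0 hFusub hFv
  have hgapbv : IsGapLength Fu (b * gv) := hgapv.right_piece ha hgu hb hFusub hFvsub hFu
  have hgapm : ∀ m : ℕ, IsGapLength Fu (b * (c ^ m * (d * gu))) := fun m => by
    refine IsGapLength.right_piece ha hgu hb hFusub hFvsub hFu ?_
    induction m with
    | zero => simpa using hgapu.right_piece hc hgv hd hFvsub hFusub hFv
    | succ m ih =>
      rw [pow_succ', mul_assoc]
      exact ih.left_piece hc hgv hd hFvsub hFusub hFv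
  choose s t hs hTst using fun i => exists_affine_of_abs_sub_eq (hr i).1 (hT i)
  have hs0 : ∀ i, s i ≠ 0 := fun i => abs_pos.mp (hs i ▸ (hr i).1)
  have hTF : ∀ i, ∀ z ∈ Fu, T i z ∈ Fu := fun i z hz => by
    rw [hcover]
    exact Set.mem_iUnion.mpr ⟨i, z, hz, rfl⟩
  have hpiece : ∀ z ∈ Fu, ∃ i, z ∈ T i '' Fu := fun z hz => by
    rw [hcover] at hz
    exact Set.mem_iUnion.mp hz
  have hsep : ∀ i, ∀ z ∈ Fu, z ∈ T i '' Set.Icc 0 1 → z ∈ T i '' Fu := fun i z hz hzi => by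
    obtain ⟨j, hj⟩ := hpiece z hz
    by_cases hij : i = j
    · exact hij ▸ hj
    · exact absurd (Set.image_mono hFusub hj) (Set.disjoint_left.mp (hdisj i j hij) hzi)
  have himage : ∀ i {ℓ : ℝ}, IsGapLength Fu ℓ → IsGapLength Fu (rT i * ℓ) := fun i ℓ h =>
    hs i ▸ h.image (hs0 i) (hTst i) (hTF i) hFusub (hsep i)
  have hratio : ∀ q, ∃ i k j : ℕ, (k = 0 → j = 0) ∧ rT q = a ^ i * (b * d) ^ k * c ^ j := by
    intro q
    rcases hpath (himage q hgapu) with ⟨i, k, j, hkj, h⟩ | ⟨i, k, j, h⟩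
    · exact ⟨i, k, j, hkj, mul_right_cancel₀ hgu.ne' (by rw [h]; ring)⟩
    · exfalso
      rcases hpath (himage q hgapbv) with ⟨i', k', j', -, h'⟩ | ⟨i', k', j', h'⟩
      · have := @hexp 0 2 i (k + 2) j k 2 0 i' k' j' k' (by
          linear_combination gu * h' - b * gv * h)
        omega
      · have := @hexp 0 2 i (k + 2) j k 1 1 i' (k' + 1) j' k' (by
          linear_combination gu * h' - b * gv * h)
        omega
  have hratio_eq : ∀ q (m : ℕ) {k : ℝ}, IsGapLength Fu k →
      b * (c ^ m * (d * gu)) = rT q * k → rT q = b * d * c ^ m := by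
    intro q m ℓ hℓ h
    obtain ⟨i, k, j, hkj, hq⟩ := hratio q
    rw [hq] at h
    rcases hpath hℓ with ⟨i', k', j', hkj', rfl⟩ | ⟨i', k', j', rfl⟩
    · obtain ⟨-, -, hi, hk, hj, -⟩ :=
        @hexp 1 0 0 1 m 1 1 0 (i + i') (k + k') (j + j') (k + k') (by linear_combination h)
      have hi0 : i = 0 := by omega
      rcases Nat.eq_zero_or_pos k with hk0 | hkpos
      · have hlt := (hr q).2
        rw [hq, hkj hk0, hk0, hi0] at hlt
        norm_num at hlt
      · have hk1 : k = 1 := by omega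
        have hj' := hkj' (by omega)
        have hjm : j = m := by omega
        rw [hq, hi0, hk1, hjm]
        ring
    · have := @hexp 1 0 0 1 m 1 0 1 (i + i') (k + k' + 1) (j + j') (k + k') (by
        linear_combination h)
      omega
  choose x hx y hy hxy hlen hgap using hgapm
  choose p hp using fun m => hpiece (x m) (hx m)
  choose q hq using fun m => hpiece (y m) (hy m)
  obtain ⟨m, m', hne, heq⟩ := Finite.exists_ne_map_eq_of_infinite fun m => (p m, q m)
  obtain ⟨hpp, hqq⟩ := Prod.mk.inj heq
  apply hne
  by_cases hpq : p m = q m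
  · have hr_eq : ∀ m, p m = q m → rT (p m) = b * d * c ^ m := fun m hm => by
      obtain ⟨k, hk, hk'⟩ := IsGapLength.of_image (hTst (p m)) (hTF (p m)) (hp m)
        (hm ▸ hq m) (hxy m) (hgap m)
      exact hratio_eq (p m) m hk (by rw [hlen, hk', hs])
    have h1 := hr_eq m hpq
    have h2 := hr_eq m' (by rw [← hpp, ← hqq, hpq])
    rw [← hpp, h1] at h2
    have := @hexp 0 0 0 1 m 1 0 0 0 1 m' 1 (by linear_combination h2)
    omega
  · have not_between : ∀ m m', p m = p m' → p m ≠ q m → ¬ y m ≤ x m' := fun m m' h hne hle =>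
      Set.disjoint_left.mp (hdisj _ _ hne)
        (mem_image_Icc_of_between (hTst _) (Set.image_mono hFusub (hp m))
          (Set.image_mono hFusub (h ▸ hp m')) (hxy m).le hle)
        (Set.image_mono hFusub (hq m))
    have hn := not_between m m' hpp hpq
    have hn' := not_between m' m hpp.symm (by rwa [← hpp, ← hqq])
    have hxx : x m = x m' := le_antisymm
      (not_lt.mp fun h => hn' (hgap m' _ (hx m) h)) (not_lt.mp fun h => hn (hgap m _ (hx m') h))
    have hyy : y m = y m' := le_antisymm
      (hgap m _ (hy m') (hxx ▸ hxy m')) (hgap m' _ (hy m) (hxx ▸ hxy m))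
    have h := (hlen m).trans ((by rw [hxx, hyy] : y m - x m = y m' - x m').trans (hlen m').symm)
    have := @hexp 1 0 0 1 m 1 1 0 0 1 m' 1 (by linear_combination h)
    omega
end
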